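/- In the tree setting with nesting (i), branching (ii) and goodness (iii), the union of the dangerous sets over all leaves satisfies |⋃_{leaves w} D_w| ≤ 1000 · 4^{2ℓ} · q^{1 + 1/(2ℓ)} · √n · log₂ n. -/

import Mathlib

open scoped Classical
open Finset

/-- Hamming weight. -/
def hwt {n : ℕ} (x : Fin n → Bool) : ℕ := (univ.filter fun i => x i = true).card

/-- `x` lies in the middle layers: `n/2 - √n ≤ |x| ≤ n/2 + √n` (with `s = √n`). -/
def MiddleLayers (n s : ℕ) (x : Fin n → Bool) : Prop :=
  n ≤ 2 * hwt x + 2 * s ∧ 2 * hwt x ≤ n + 2 * s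

/-- `A_{u,b}`: the coordinates on which all points of `S` equal `b`. -/
def Aset {n : ℕ} (S : Finset (Fin n → Bool)) (b : Bool) : Finset (Fin n) :=
  univ.filter fun i => ∀ x ∈ S, x i = b

/-- Nodes of the complete `N`-ary tree of depth `2ℓ` are encoded as lists over
`Fin N` of length at most `2ℓ` (the list of child indices from the node up to the
root, most recent first; the root is `[]` and the children of `u` are `a :: u`).
`Bset ℓ P u` is the union, over the leaves `w ++ u` of the subtree rooted at `u`,
of the dangerous sets `D_{w++u} = {i : ∃ x y ∈ P_{w++u}, x i ≠ y i}`. -/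
noncomputable def Bset (ℓ : ℕ) {n N : ℕ} (P : List (Fin N) → Finset (Fin n → Bool))
    (u : List (Fin N)) : Finset (Fin n) :=
  univ.filter fun i => ∃ w : List (Fin N), w.length + u.length = 2 * ℓ ∧
    ∃ x ∈ P (w ++ u), ∃ y ∈ P (w ++ u), x i ≠ y i

/-- The coordinates on which two points of `S` differ. -/
noncomputable def dangerousSet {n : ℕ} (S : Finset (Fin n → Bool)) : Finset (Fin n) :=
  univ.filter fun i => ∃ x ∈ S, ∃ y ∈ S, x i ≠ y i

theorem mem_dangerousSet {n : ℕ} {S : Finset (Fin n → Bool)} {i : Fin n} :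
    i ∈ dangerousSet S ↔ ∃ x ∈ S, ∃ y ∈ S, x i ≠ y i := by
  simp [dangerousSet]

theorem mem_Aset {n : ℕ} {S : Finset (Fin n → Bool)} {b : Bool} {i : Fin n} :
    i ∈ Aset S b ↔ ∀ x ∈ S, x i = b := by
  simp [Aset]

theorem Aset_anti {n : ℕ} {S T : Finset (Fin n → Bool)} (h : S ⊆ T) (b : Bool) :
    Aset T b ⊆ Aset S b := fun _ hi =>
  mem_Aset.2 fun x hx => mem_Aset.1 hi x (h hx)

theorem dangerousSet_mono {n : ℕ} {S T : Finset (Fin n → Bool)} (h : S ⊆ T) :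
    dangerousSet S ⊆ dangerousSet T := fun _ hi => by
  obtain ⟨x, hx, y, hy, hxy⟩ := mem_dangerousSet.1 hi
  exact mem_dangerousSet.2 ⟨x, h hx, y, h hy, hxy⟩

theorem disjoint_dangerousSet_Aset {n : ℕ} (S : Finset (Fin n → Bool)) (b : Bool) :
    Disjoint (dangerousSet S) (Aset S b) := by
  rw [Finset.disjoint_left]
  intro i hi hA
  obtain ⟨x, hx, y, hy, hxy⟩ := mem_dangerousSet.1 hi
  exact hxy ((mem_Aset.1 hA x hx).trans (mem_Aset.1 hA y hy).symm)

theorem disjoint_Aset {n : ℕ} {S : Finset (Fin n → Bool)} (hS : S.Nonempty) {b c : Bool}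
    (hbc : b ≠ c) : Disjoint (Aset S b) (Aset S c) := by
  rw [Finset.disjoint_left]
  intro i hb hc
  obtain ⟨x, hx⟩ := hS
  exact hbc ((mem_Aset.1 hb x hx).symm.trans (mem_Aset.1 hc x hx))

theorem card_dangerousSet_add_card_Aset_le {n : ℕ} {S : Finset (Fin n → Bool)}
    (hS : S.Nonempty) {b c : Bool} (hbc : b ≠ c) :
    (dangerousSet S).card + ((Aset S b).card + (Aset S c).card) ≤ n := by
  rw [← Finset.card_union_of_disjoint (disjoint_Aset hS hbc), ← Finset.card_union_of_disjoint]
  · exact (card_le_univ _).trans_eq (Fintype.card_fin n)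
  · exact disjoint_union_right.2
      ⟨disjoint_dangerousSet_Aset S b, disjoint_dangerousSet_Aset S c⟩

theorem MiddleLayers.card_filter_eq_le {n s : ℕ} {x : Fin n → Bool} (hx : MiddleLayers n s x)
    (b : Bool) : 2 * (univ.filter fun i => x i = b).card ≤ n + 2 * s := by
  obtain ⟨h₁, h₂⟩ := hx
  cases b with
  | true => exact h₂
  | false =>
    have h := card_filter_add_card_filter_not (s := (univ : Finset (Fin n)))
      (fun i => x i = true)
    simp only [Bool.not_eq_true, card_univ, Fintype.card_fin] at h
    simp only [hwt] at h₁
    omega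

/-- Each point of `S` has few coordinates equal to `b` outside `Aset S b`. -/
theorem card_dangerousSet_le {n s : ℕ} {S : Finset (Fin n → Bool)} {b : Bool} {C : ℝ}
    (hmid : ∀ x ∈ S, MiddleLayers n s x)
    (hgood : (n : ℝ) / 2 - C * S.card ≤ (Aset S b).card) :
    ((dangerousSet S).card : ℝ) ≤ S.card * (C * S.card + s) := by
  have hsub : dangerousSet S ⊆
      S.biUnion fun x => (univ.filter fun i => x i = b) \ Aset S b := by
    intro i hi
    obtain ⟨x, hx, y, hy, hxy⟩ := mem_dangerousSet.1 hi
    have hA := Finset.disjoint_left.1 (disjoint_dangerousSet_Aset S b) hi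
    rw [mem_biUnion]
    by_cases hb : x i = b
    · exact ⟨x, hx, by simp [hb, hA]⟩
    · refine ⟨y, hy, ?_⟩
      have : y i = b := by
        revert hxy hb
        cases x i <;> cases y i <;> cases b <;> simp
      simp [this, hA]
  have hpt : ∀ x ∈ S, (((univ.filter fun i => x i = b) \ Aset S b).card : ℝ) ≤
      C * S.card + s := by
    intro x hx
    have hAx : Aset S b ⊆ univ.filter fun i => x i = b := fun i hi => by
      simpa using mem_Aset.1 hi x hx
    rw [cast_card_sdiff hAx]
    have h : (2 : ℝ) * (univ.filter fun i => x i = b).card ≤ n + 2 * s := by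
      exact_mod_cast (hmid x hx).card_filter_eq_le b
    linarith
  calc ((dangerousSet S).card : ℝ)
      ≤ ∑ x ∈ S, (((univ.filter fun i => x i = b) \ Aset S b).card : ℝ) := by
        exact_mod_cast (card_le_card hsub).trans card_biUnion_le
    _ ≤ ∑ _x ∈ S, (C * S.card + s) := sum_le_sum hpt
    _ = S.card * (C * S.card + s) := by rw [sum_const, nsmul_eq_mul]

section Tree

variable {ℓ n N : ℕ} {P : List (Fin N) → Finset (Fin n → Bool)}

theorem mem_Bset {u : List (Fin N)} {i : Fin n} :
    i ∈ Bset ℓ P u ↔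
      ∃ w : List (Fin N), w.length + u.length = 2 * ℓ ∧ i ∈ dangerousSet (P (w ++ u)) := by
  simp [Bset, dangerousSet]

theorem Bset_subset_biUnion_children {u : List (Fin N)} (hu : u.length < 2 * ℓ) :
    Bset ℓ P u ⊆ univ.biUnion fun a => Bset ℓ P (a :: u) := by
  intro i hi
  obtain ⟨w, hw, hiw⟩ := mem_Bset.1 hi
  rcases List.eq_nil_or_concat' w with rfl | ⟨w', a, rfl⟩
  · simp at hw
    omega
  · refine mem_biUnion.2 ⟨a, mem_univ a, mem_Bset.2 ⟨w', ?_, ?_⟩⟩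
    · simp at hw ⊢
      omega
    · simpa using hiw

theorem card_Bset_le_sum {u : List (Fin N)} (hu : u.length < 2 * ℓ) :
    ((Bset ℓ P u).card : ℝ) ≤ ∑ a, ((Bset ℓ P (a :: u)).card : ℝ) := by
  exact_mod_cast (card_le_card (Bset_subset_biUnion_children hu)).trans card_biUnion_le

theorem subset_of_append
    (hnest : ∀ u : List (Fin N), 1 ≤ u.length → u.length ≤ 2 * ℓ - 1 →
      ∀ a : Fin N, P (a :: u) ⊆ P u) {u : List (Fin N)} (hu : 1 ≤ u.length) :
    ∀ w : List (Fin N), w.length + u.length ≤ 2 * ℓ → P (w ++ u) ⊆ P u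
  | [], _ => Subset.rfl
  | a :: w, hw => by
    simp only [List.length_cons] at hw
    have h := hnest (w ++ u) (by simp; omega) (by simp; omega) a
    exact h.trans (subset_of_append hnest hu w (by omega))

theorem Bset_subset_dangerousSet
    (hnest : ∀ u : List (Fin N), 1 ≤ u.length → u.length ≤ 2 * ℓ - 1 →
      ∀ a : Fin N, P (a :: u) ⊆ P u) {u : List (Fin N)} (hu : 1 ≤ u.length) :
    Bset ℓ P u ⊆ dangerousSet (P u) := by
  intro i hi
  obtain ⟨w, hw, hiw⟩ := mem_Bset.1 hi
  exact dangerousSet_mono (subset_of_append hnest hu w hw.le) hiw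

/-- The trade-off between the inductive bound for a child with `m` points and the bound coming
from goodness of the child and of its parent with `q` points. -/
theorem le_mul_rpow_of_le_of_le {B K C m q : ℝ} {h : ℕ} (hK : 2 ≤ K) (hC : 0 ≤ C) (hm : 1 ≤ m)
    (hmq : m ≤ q) (h₁ : B ≤ K * C * m ^ ((1 : ℝ) + 1 / ((h : ℝ) + 1))) (h₂ : B ≤ C * (m + q)) :
    B ≤ K * C * (m * q ^ ((1 : ℝ) / ((h : ℝ) + 2))) := by
  have hm0 : 0 < m := by linarith
  have hq0 : 0 < q := by linarith
  have hh1 : (0 : ℝ) < (h : ℝ) + 1 := by positivity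
  have hh2 : (0 : ℝ) < (h : ℝ) + 2 := by positivity
  have hKC : 0 ≤ K * C := mul_nonneg (by linarith) hC
  rcases le_total m (q ^ (((h : ℝ) + 1) / ((h : ℝ) + 2))) with hle | hle
  · refine h₁.trans (mul_le_mul_of_nonneg_left ?_ hKC)
    rw [Real.rpow_add hm0, Real.rpow_one]
    refine mul_le_mul_of_nonneg_left ?_ hm0.le
    calc m ^ ((1 : ℝ) / ((h : ℝ) + 1))
        ≤ (q ^ (((h : ℝ) + 1) / ((h : ℝ) + 2))) ^ ((1 : ℝ) / ((h : ℝ) + 1)) :=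
          Real.rpow_le_rpow hm0.le hle (by positivity)
      _ = q ^ ((1 : ℝ) / ((h : ℝ) + 2)) := by
          rw [← Real.rpow_mul hq0.le]
          congr 1
          field_simp
  · have hq : q ≤ m * q ^ ((1 : ℝ) / ((h : ℝ) + 2)) := by
      calc q = q ^ (((h : ℝ) + 1) / ((h : ℝ) + 2)) * q ^ ((1 : ℝ) / ((h : ℝ) + 2)) := by
            rw [← Real.rpow_add hq0, ← add_div]
            rw [show (h : ℝ) + 1 + 1 = (h : ℝ) + 2 by ring, div_self hh2.ne', Real.rpow_one]
        _ ≤ m * q ^ ((1 : ℝ) / ((h : ℝ) + 2)) :=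
            mul_le_mul_of_nonneg_right hle (by positivity)
    calc B ≤ C * (m + q) := h₂
      _ ≤ C * (2 * q) := mul_le_mul_of_nonneg_left (by linarith) hC
      _ = 2 * C * q := by ring
      _ ≤ K * C * q := by gcongr
      _ ≤ K * C * (m * q ^ ((1 : ℝ) / ((h : ℝ) + 2))) := mul_le_mul_of_nonneg_left hq hKC

/-- The bound on `Bset` for a non-root node, by induction on its height `h`. -/
theorem card_Bset_le {s : ℕ} {C : ℝ} (hsC : (s : ℝ) ≤ C)
    (hmid : ∀ u : List (Fin N), 1 ≤ u.length → u.length ≤ 2 * ℓ →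
      ∀ x ∈ P u, MiddleLayers n s x)
    (hnest : ∀ u : List (Fin N), 1 ≤ u.length → u.length ≤ 2 * ℓ - 1 →
      ∀ a : Fin N, P (a :: u) ⊆ P u)
    (hbr : ∀ u : List (Fin N), 1 ≤ u.length → u.length ≤ 2 * ℓ - 1 →
      ∑ a : Fin N, (P (a :: u)).card ≤ 2 * (P u).card)
    (hgood : ∀ u : List (Fin N), 1 ≤ u.length → u.length ≤ 2 * ℓ → (P u).Nonempty →
      (n : ℝ) / 2 - C * (P u).card ≤ (Aset (P u) (decide (u.length % 2 = 1))).card)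
    (h : ℕ) : ∀ u : List (Fin N), 1 ≤ u.length → u.length + h = 2 * ℓ →
      ((Bset ℓ P u).card : ℝ) ≤
        2 ^ (h + 1) * C * ((P u).card : ℝ) ^ ((1 : ℝ) + 1 / ((h : ℝ) + 1)) := by
  have hC : 0 ≤ C := (Nat.cast_nonneg s).trans hsC
  have hempty : ∀ u : List (Fin N), 1 ≤ u.length → P u = ∅ → (Bset ℓ P u).card = 0 := by
    intro u hu hPu
    have := Bset_subset_dangerousSet hnest hu
    rw [hPu] at this
    exact card_eq_zero.2 (subset_empty.1 (by simpa [dangerousSet] using this))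
  have hone : ∀ u : List (Fin N), (P u).Nonempty → (1 : ℝ) ≤ (P u).card := fun u hu => by
    exact_mod_cast hu.card_pos
  induction h with
  | zero =>
    intro u hu hlen
    rcases (P u).eq_empty_or_nonempty with hPu | hPu
    · rw [hempty u hu hPu]
      push_cast
      positivity
    · have h₁ := card_dangerousSet_le (hmid u hu (by omega)) (hgood u hu (by omega) hPu)
      have h₂ : ((Bset ℓ P u).card : ℝ) ≤ (dangerousSet (P u)).card := by
        exact_mod_cast card_le_card (Bset_subset_dangerousSet hnest hu)
      have hm := hone u hPu
      have hs : (s : ℝ) ≤ C * (P u).card := by nlinarith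
      have he : ((P u).card : ℝ) ^ ((1 : ℝ) + 1 / (((0 : ℕ) : ℝ) + 1)) =
          (P u).card * (P u).card := by
        rw [show (1 : ℝ) + 1 / (((0 : ℕ) : ℝ) + 1) = ((2 : ℕ) : ℝ) by norm_num,
          Real.rpow_natCast, sq]
      rw [he]
      calc ((Bset ℓ P u).card : ℝ) ≤ (P u).card * (C * (P u).card + s) := h₂.trans h₁
        _ ≤ (P u).card * (C * (P u).card + C * (P u).card) := by gcongr
        _ = 2 ^ (0 + 1) * C * ((P u).card * (P u).card) := by ring
  | succ h ih =>
    intro u hu hlen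
    rcases (P u).eq_empty_or_nonempty with hPu | hPu
    · rw [hempty u hu hPu]
      push_cast
      positivity
    · set q : ℝ := ((P u).card : ℝ) with hq
      have hq1 : 1 ≤ q := hone u hPu
      have hchild : ∀ a : Fin N, ((Bset ℓ P (a :: u)).card : ℝ) ≤
          2 ^ (h + 1) * C * ((P (a :: u)).card * q ^ ((1 : ℝ) / ((h : ℝ) + 2))) := by
        intro a
        have hv : 1 ≤ (a :: u).length := by simp
        rcases (P (a :: u)).eq_empty_or_nonempty with hPv | hPv
        · rw [hempty _ hv hPv]
          push_cast
          positivity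
        have hsub := hnest u hu (by omega) a
        refine le_mul_rpow_of_le_of_le ?_ hC (hone _ hPv) ?_
          (ih (a :: u) hv (by simp; omega)) ?_
        · rw [pow_succ]
          linarith [one_le_pow₀ (one_le_two : (1 : ℝ) ≤ 2) (n := h)]
        · rw [hq]
          exact_mod_cast card_le_card hsub
        · have h₁ := hgood u hu (by omega) hPu
          have h₂ := hgood (a :: u) hv (by simp; omega) hPv
          have hbit : decide (u.length % 2 = 1) ≠ decide ((a :: u).length % 2 = 1) := by
            simp only [List.length_cons, ne_eq, decide_eq_decide]
            omega
          have h₃ : ((Aset (P u) (decide (u.length % 2 = 1))).card : ℝ) ≤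
              (Aset (P (a :: u)) (decide (u.length % 2 = 1))).card := by
            exact_mod_cast card_le_card (Aset_anti hsub _)
          have h₄ : ((dangerousSet (P (a :: u))).card : ℝ) +
              ((Aset (P (a :: u)) (decide (u.length % 2 = 1))).card +
                (Aset (P (a :: u)) (decide ((a :: u).length % 2 = 1))).card) ≤ n := by
            exact_mod_cast card_dangerousSet_add_card_Aset_le hPv hbit
          have h₅ : ((Bset ℓ P (a :: u)).card : ℝ) ≤ (dangerousSet (P (a :: u))).card := by
            exact_mod_cast card_le_card (Bset_subset_dangerousSet hnest hv)
          linarith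
      have hsum : (∑ a : Fin N, ((P (a :: u)).card : ℝ)) ≤ 2 * q := by
        rw [hq]
        exact_mod_cast hbr u hu (by omega)
      calc ((Bset ℓ P u).card : ℝ)
          ≤ ∑ a, ((Bset ℓ P (a :: u)).card : ℝ) := card_Bset_le_sum (by omega)
        _ ≤ ∑ a : Fin N,
              2 ^ (h + 1) * C * ((P (a :: u)).card * q ^ ((1 : ℝ) / ((h : ℝ) + 2))) :=
            sum_le_sum fun a _ => hchild a
        _ = 2 ^ (h + 1) * C *
              ((∑ a : Fin N, ((P (a :: u)).card : ℝ)) * q ^ ((1 : ℝ) / ((h : ℝ) + 2))) := by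
            rw [← mul_sum, sum_mul]
        _ ≤ 2 ^ (h + 1) * C * (2 * q * q ^ ((1 : ℝ) / ((h : ℝ) + 2))) := by gcongr
        _ = 2 ^ (h + 1 + 1) * C * q ^ ((1 : ℝ) + 1 / (((h + 1 : ℕ) : ℝ) + 1)) := by
            rw [Real.rpow_add (by linarith), Real.rpow_one]
            push_cast
            rw [show (h : ℝ) + 1 + 1 = (h : ℝ) + 2 by ring]
            ring

end Tree

/-- Superadditivity of `x ↦ x ^ p` on the nonnegative reals, for `1 ≤ p`, in the form of a bound
by the total. -/
theorem sum_rpow_one_add_le {ι : Type*} (t : Finset ι) (f : ι → ℝ) (hf : ∀ i ∈ t, 0 ≤ f i)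
    {Q e : ℝ} (he : 0 ≤ e) (hQ : ∑ i ∈ t, f i ≤ Q) :
    ∑ i ∈ t, f i ^ (1 + e) ≤ Q ^ (1 + e) := by
  have hQ0 : 0 ≤ Q := (sum_nonneg hf).trans hQ
  calc ∑ i ∈ t, f i ^ (1 + e)
      ≤ ∑ i ∈ t, f i * Q ^ e := by
        refine sum_le_sum fun i hi => ?_
        rw [Real.rpow_add_of_nonneg (hf i hi) zero_le_one he, Real.rpow_one]
        exact mul_le_mul_of_nonneg_left (Real.rpow_le_rpow (hf i hi)
          ((single_le_sum hf hi).trans hQ) he) (hf i hi)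
    _ = (∑ i ∈ t, f i) * Q ^ e := by rw [sum_mul]
    _ ≤ Q * Q ^ e := mul_le_mul_of_nonneg_right hQ (Real.rpow_nonneg hQ0 e)
    _ = Q ^ (1 + e) := by rw [Real.rpow_add_of_nonneg hQ0 zero_le_one he, Real.rpow_one]

/-- with nesting (i), branching (ii) and goodness (iii), the union of
the dangerous sets over all leaves (which is `Bset ℓ P []`, the `B`-set of the root)
satisfies `|⋃_w D_w| ≤ 1000 · 4^{2ℓ} · q^{1+1/(2ℓ)} · √n · log₂ n`. -/
theorem stmt10 (ℓ n s q : ℕ) (hℓ : 1 ≤ ℓ) (hn : 2 ≤ n) (hs : s * s = n) (hq : 1 ≤ q)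
    (N : ℕ) (hN : N = 2 ^ s)
    (P : List (Fin N) → Finset (Fin n → Bool))
    (hmid : ∀ u : List (Fin N), 1 ≤ u.length → u.length ≤ 2 * ℓ →
      ∀ x ∈ P u, MiddleLayers n s x)
    (hnest : ∀ u : List (Fin N), 1 ≤ u.length → u.length ≤ 2 * ℓ - 1 →
      ∀ a : Fin N, P (a :: u) ⊆ P u)
    (hbr : ∀ u : List (Fin N), 1 ≤ u.length → u.length ≤ 2 * ℓ - 1 →
      ∑ a : Fin N, (P (a :: u)).card ≤ 2 * (P u).card)
    (hbr0 : ∑ a : Fin N, (P [a]).card ≤ 2 * q)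
    (hgood1 : ∀ u : List (Fin N), u.length % 2 = 1 → u.length ≤ 2 * ℓ →
      (P u).Nonempty →
      (n : ℝ) / 2 - 100 * s * Real.logb 2 n * (P u).card ≤ ((Aset (P u) true).card : ℝ))
    (hgood0 : ∀ u : List (Fin N), u.length % 2 = 0 → 1 ≤ u.length → u.length ≤ 2 * ℓ →
      (P u).Nonempty →
      (n : ℝ) / 2 - 100 * s * Real.logb 2 n * (P u).card ≤ ((Aset (P u) false).card : ℝ)) :
    ((Bset ℓ P []).card : ℝ) ≤
      1000 * (4 : ℝ) ^ (2 * ℓ) * (q : ℝ) ^ ((1 : ℝ) + 1 / (2 * (ℓ : ℝ))) *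
        s * Real.logb 2 n := by
  set L := Real.logb 2 n with hL
  have hL1 : 1 ≤ L := by
    rw [hL, Real.le_logb_iff_rpow_le one_lt_two (by positivity), Real.rpow_one]
    exact_mod_cast hn
  set C : ℝ := 100 * s * L with hCdef
  have hs0 : (0 : ℝ) ≤ s := Nat.cast_nonneg s
  have hsC : (s : ℝ) ≤ C := by nlinarith
  have hC : 0 ≤ C := hs0.trans hsC
  have hgood : ∀ u : List (Fin N), 1 ≤ u.length → u.length ≤ 2 * ℓ → (P u).Nonempty →
      (n : ℝ) / 2 - C * (P u).card ≤ (Aset (P u) (decide (u.length % 2 = 1))).card := by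
    intro u hu hu' hPu
    rcases Nat.mod_two_eq_zero_or_one u.length with hpar | hpar
    · simpa [hpar] using hgood0 u hpar hu hu' hPu
    · simpa [hpar] using hgood1 u hpar hu' hPu
  have hℓ' : (1 : ℝ) ≤ ℓ := by exact_mod_cast hℓ
  set e : ℝ := 1 / (2 * (ℓ : ℝ)) with he
  have he0 : 0 ≤ e := by positivity
  have he1 : e ≤ 1 := by
    rw [he, div_le_one (by positivity)]
    linarith
  have hchild : ∀ a : Fin N, ((Bset ℓ P [a]).card : ℝ) ≤
      2 ^ (2 * ℓ) * C * ((P [a]).card : ℝ) ^ (1 + e) := by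
    intro a
    have h := card_Bset_le hsC hmid hnest hbr hgood (2 * ℓ - 1) [a] (by simp) (by simp; omega)
    rwa [← Nat.cast_add_one, Nat.sub_add_cancel (by omega), Nat.cast_mul, Nat.cast_two] at h
  have hsum : (∑ a : Fin N, ((P [a]).card : ℝ)) ≤ 2 * q := by exact_mod_cast hbr0
  have htwo : (2 : ℝ) ^ (1 + e) ≤ 4 := by
    calc (2 : ℝ) ^ (1 + e) ≤ 2 ^ (2 : ℝ) :=
          Real.rpow_le_rpow_of_exponent_le one_le_two (by linarith)
      _ = 4 := by norm_num
  have hpow : (2 : ℝ) ^ (2 * ℓ) ≤ 4 ^ (2 * ℓ) := by gcongr; norm_num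
  calc ((Bset ℓ P []).card : ℝ)
      ≤ ∑ a, ((Bset ℓ P [a]).card : ℝ) := card_Bset_le_sum (by simp; omega)
    _ ≤ ∑ a : Fin N, 2 ^ (2 * ℓ) * C * ((P [a]).card : ℝ) ^ (1 + e) :=
        sum_le_sum fun a _ => hchild a
    _ = 2 ^ (2 * ℓ) * C * ∑ a : Fin N, ((P [a]).card : ℝ) ^ (1 + e) := by rw [mul_sum]
    _ ≤ 2 ^ (2 * ℓ) * C * (2 * (q : ℝ)) ^ (1 + e) := by
        gcongr
        exact sum_rpow_one_add_le _ _ (fun _ _ => Nat.cast_nonneg _) he0 hsum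
    _ = 2 ^ (2 * ℓ) * C * (2 ^ (1 + e) * (q : ℝ) ^ (1 + e)) := by
        rw [Real.mul_rpow zero_le_two (Nat.cast_nonneg q)]
    _ ≤ 4 ^ (2 * ℓ) * C * (4 * (q : ℝ) ^ (1 + e)) := by gcongr
    _ = 400 * (4 ^ (2 * ℓ) * (q : ℝ) ^ (1 + e) * s * L) := by
        rw [hCdef]
        ring
    _ ≤ 1000 * (4 ^ (2 * ℓ) * (q : ℝ) ^ (1 + e) * s * L) := by gcongr; norm_num
    _ = 1000 * 4 ^ (2 * ℓ) * (q : ℝ) ^ (1 + e) * s * L := by ring
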